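/- arXiv:1306.2064 — 2 statements merged into one kernel-verified Lean document; each statement's English description precedes it below -/
import Mathlib

section
/- Let N ≥ 3, a, b > 0 and g : ℝ → ℝ. Suppose v ∈ C²(ℝ^N) with ∫_{ℝ^N}|∇v|² < ∞ satisfies −Δv(x) = g(v(x)) for all x ∈ ℝ^N, and suppose t > 0 satisfies t²·a + t^{4−N}·b·∫_{ℝ^N}|∇v|² = 1. Then the function u defined by u(x) = v(t·x) belongs to C²(ℝ^N), satisfies ∫_{ℝ^N}|∇u|² < ∞, and satisfies the Kirchhoff equation −(a + b∫_{ℝ^N}|∇u|²)·Δu(x) = g(u(x)) for all x ∈ ℝ^N. -/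
open MeasureTheory

/-- The Laplacian of `u : ℝ^N → ℝ`, as the sum of second partial derivatives
along the standard basis directions. -/
noncomputable def lap {N : ℕ} (u : EuclideanSpace ℝ (Fin N) → ℝ)
    (x : EuclideanSpace ℝ (Fin N)) : ℝ :=
  ∑ i : Fin N,
    fderiv ℝ (fun y => fderiv ℝ u y (EuclideanSpace.single i 1)) x (EuclideanSpace.single i 1)

/-- The Dirichlet energy `∫_{ℝ^N} |∇u|²`. -/
noncomputable def dirichlet {N : ℕ} (u : EuclideanSpace ℝ (Fin N) → ℝ) : ℝ :=
  ∫ x, ‖gradient u x‖ ^ 2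

lemma gradient_comp_smul {F : Type*} [NormedAddCommGroup F] [InnerProductSpace ℝ F]
    [CompleteSpace F] (f : F → ℝ) (t : ℝ) (x : F) :
    gradient (fun y => f (t • y)) x = t • gradient f (t • x) := by
  simp only [gradient, fderiv_comp_smul, map_smul]

lemma norm_gradient_comp_smul_sq {F : Type*} [NormedAddCommGroup F] [InnerProductSpace ℝ F]
    [CompleteSpace F] (f : F → ℝ) (t : ℝ) (x : F) :
    ‖gradient (fun y => f (t • y)) x‖ ^ 2 = t ^ 2 * ‖gradient f (t • x)‖ ^ 2 := by
  rw [gradient_comp_smul, norm_smul, mul_pow, Real.norm_eq_abs, sq_abs]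

lemma lap_comp_smul {N : ℕ} (v : EuclideanSpace ℝ (Fin N) → ℝ) (t : ℝ)
    (x : EuclideanSpace ℝ (Fin N)) :
    lap (fun y => v (t • y)) x = t ^ 2 * lap v (t • x) := by
  simp only [lap, Finset.mul_sum]
  refine Finset.sum_congr rfl fun i _ => ?_
  have h : (fun y => fderiv ℝ (fun z => v (t • z)) y (EuclideanSpace.single i 1)) =
      t • fun y => fderiv ℝ v (t • y) (EuclideanSpace.single i 1) := by
    funext y
    simp [fderiv_comp_smul]
  rw [h, fderiv_const_smul_field, Pi.smul_apply,
    fderiv_comp_smul (f := fun y => fderiv ℝ v y (EuclideanSpace.single i 1))]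
  simp only [smul_apply, smul_eq_mul]
  ring

lemma dirichlet_comp_smul {N : ℕ} (v : EuclideanSpace ℝ (Fin N) → ℝ) {t : ℝ} (ht : 0 ≤ t) :
    dirichlet (fun y => v (t • y)) = t ^ 2 * ((t ^ N)⁻¹ * dirichlet v) := by
  simp only [dirichlet, norm_gradient_comp_smul_sq]
  rw [integral_const_mul, Measure.integral_comp_smul_of_nonneg volume
    (fun x => ‖gradient v x‖ ^ 2) t (hR := ht), finrank_euclideanSpace_fin, smul_eq_mul]

theorem stmt0 {N : ℕ} (hN : 3 ≤ N) (a b : ℝ) (ha : 0 < a) (hb : 0 < b)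
    (g : ℝ → ℝ) (v : EuclideanSpace ℝ (Fin N) → ℝ)
    (hv : ContDiff ℝ 2 v)
    (hvInt : Integrable (fun x => ‖gradient v x‖ ^ 2))
    (hvEq : ∀ x, -lap v x = g (v x))
    (t : ℝ) (ht : 0 < t)
    (htEq : t ^ 2 * a + t ^ ((4 : ℝ) - N) * b * dirichlet v = 1) :
    ContDiff ℝ 2 (fun x => v (t • x)) ∧
    Integrable (fun x => ‖gradient (fun y => v (t • y)) x‖ ^ 2) ∧
    ∀ x, -((a + b * dirichlet (fun y => v (t • y))) * lap (fun y => v (t • y)) x)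
        = g (v (t • x)) := by
  refine ⟨hv.comp (contDiff_const_smul t), ?_, fun x => ?_⟩
  · simp only [norm_gradient_comp_smul_sq]
    exact (hvInt.comp_smul ht.ne').const_mul _
  · have hpow : t ^ ((4 : ℝ) - N) = t ^ 4 * (t ^ N)⁻¹ := by
      rw [Real.rpow_sub ht, Real.rpow_natCast, div_eq_mul_inv]
      norm_cast
    rw [hpow] at htEq
    rw [← hvEq, lap_comp_smul, dirichlet_comp_smul v ht.le]
    linear_combination -lap v (t • x) * htEq
end

section
/- Let N = 3 or N = 4, and let a, b > 0. Suppose 0 < V₁ < V₂ are real numbers (with the additional assumption b·V₂ < 1 when N = 4), and suppose t₁, t₂ > 0 satisfy a·t₁² + b·t₁^{4−N}·V₁ = 1 and a·t₂² + b·t₂^{4−N}·V₂ = 1. Then t₂ < t₁ and (a/4)·V₁·t₁^{2−N} + ((4−N)/(4N))·V₁·t₁^{−N} < (a/4)·V₂·t₂^{2−N} + ((4−N)/(4N))·V₂·t₂^{−N}. -/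
theorem stmt7 {N : ℕ} (hN : N = 3 ∨ N = 4) (a b : ℝ) (ha : 0 < a) (hb : 0 < b)
    (V₁ V₂ : ℝ) (hV₁ : 0 < V₁) (hV : V₁ < V₂)
    (hN4 : N = 4 → b * V₂ < 1)
    (t₁ t₂ : ℝ) (ht₁ : 0 < t₁) (ht₂ : 0 < t₂)
    (hc₁ : a * t₁ ^ 2 + b * t₁ ^ ((4 : ℝ) - N) * V₁ = 1)
    (hc₂ : a * t₂ ^ 2 + b * t₂ ^ ((4 : ℝ) - N) * V₂ = 1) :
    t₂ < t₁ ∧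
    (a / 4) * V₁ * t₁ ^ ((2 : ℝ) - N) + ((4 - N) / (4 * N)) * V₁ * t₁ ^ (-(N : ℝ))
      < (a / 4) * V₂ * t₂ ^ ((2 : ℝ) - N) + ((4 - N) / (4 * N)) * V₂ * t₂ ^ (-(N : ℝ)) := by
  have hN3 : (3 : ℝ) ≤ N := by rcases hN with rfl | rfl <;> norm_num
  have hN_le : (N : ℝ) ≤ 4 := by rcases hN with rfl | rfl <;> norm_num
  have ht : t₂ < t₁ := by
    by_contra! h
    have h_sq : a * t₁ ^ 2 ≤ a * t₂ ^ 2 := by gcongr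
    have h_pow : t₁ ^ ((4 : ℝ) - N) ≤ t₂ ^ ((4 : ℝ) - N) :=
      Real.rpow_le_rpow ht₁.le h (by linarith)
    have h_lt : b * t₁ ^ ((4 : ℝ) - N) * V₁ < b * t₂ ^ ((4 : ℝ) - N) * V₂ :=
      mul_lt_mul' (by gcongr) hV hV₁.le (by positivity)
    linarith
  refine ⟨ht, add_lt_add_of_lt_of_le ?_ ?_⟩
  · have h_pow : t₁ ^ ((2 : ℝ) - N) < t₂ ^ ((2 : ℝ) - N) :=
      Real.rpow_lt_rpow_of_neg ht₂ ht (by linarith)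
    have hV₂ : 0 < V₂ := hV₁.trans hV
    gcongr
  · have h_pow : t₁ ^ (-(N : ℝ)) ≤ t₂ ^ (-(N : ℝ)) :=
      (Real.rpow_lt_rpow_of_neg ht₂ ht (by linarith)).le
    have hV₂ : 0 < V₂ := hV₁.trans hV
    have h_coeff : 0 ≤ (4 - (N : ℝ)) / (4 * N) := div_nonneg (by linarith) (by positivity)
    gcongr
end
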